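/- Let E be a Hausdorff topological space and n ≥ 1. Let γ : unitInterval → (Fin n → E) be continuous with γ t injective for every t, and let σ : Equiv.Perm (Fin n) be a permutation with γ 1 = γ 0 ∘ σ and γ 0 ∘ σ ≠ γ 0. Then there is no continuous map F : unitInterval → (Fin n → E) with F 0 = F 1 such that for every t there exists a permutation τ : Equiv.Perm (Fin n) with F t = γ t ∘ τ. -/

import Mathlib

/-- On a preconnected space, a continuous ordered listing of a continuous family of injective
configurations differs from the family by one fixed permutation. -/
theorem exists_perm_forall_eq_comp {X ι E : Type*} [TopologicalSpace X] [PreconnectedSpace X]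
    [Nonempty X] [TopologicalSpace E] [T2Space E] [Finite ι] {γ F : X → ι → E}
    (hγ : Continuous γ) (hinj : ∀ x, Function.Injective (γ x)) (hF : Continuous F)
    (h : ∀ x, ∃ τ : Equiv.Perm ι, F x = γ x ∘ τ) :
    ∃ τ : Equiv.Perm ι, ∀ x, F x = γ x ∘ τ := by
  have hclosed (τ : Equiv.Perm ι) : IsClosed {x | F x = γ x ∘ τ} :=
    isClosed_eq hF (continuous_pi fun i => (continuous_apply (τ i)).comp hγ)
  obtain ⟨x₀⟩ := ‹Nonempty X›
  obtain ⟨τ, hτ⟩ := h x₀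
  have hcompl : {x | F x = γ x ∘ τ}ᶜ = ⋃ ρ : {ρ : Equiv.Perm ι // ρ ≠ τ},
      {x | F x = γ x ∘ ρ.1} := by
    ext x
    simp only [Set.mem_compl_iff, Set.mem_ofPred_eq, Set.mem_iUnion, Subtype.exists, exists_prop]
    constructor
    · intro hx
      obtain ⟨ρ, hρ⟩ := h x
      exact ⟨ρ, fun e => hx (e ▸ hρ), hρ⟩
    · rintro ⟨ρ, hne, hρ⟩ hx
      exact hne (Equiv.ext fun i => hinj x (congrFun (hρ.symm.trans hx) i))
  have hopen : IsOpen {x | F x = γ x ∘ τ} := by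
    rw [← isClosed_compl_iff, hcompl]
    exact isClosed_iUnion_of_finite fun ρ => hclosed ρ.1
  have huniv := IsClopen.eq_univ ⟨hclosed τ, hopen⟩ ⟨x₀, hτ⟩
  exact ⟨τ, Set.eq_univ_iff_forall.mp huniv⟩

/-- The key loop argument: along a curve of injective configurations returning to a
genuinely permuted copy of its start, no continuous choice of ordered listing can
close up into a loop. -/
theorem no_continuous_loop_listing (E : Type*) [TopologicalSpace E] [T2Space E]
    (n : ℕ) (hn : 1 ≤ n)
    (γ : unitInterval → (Fin n → E)) (hγ : Continuous γ)
    (hinj : ∀ t, Function.Injective (γ t))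
    (σ : Equiv.Perm (Fin n)) (hσ : γ 1 = γ 0 ∘ σ) (hne : γ 0 ∘ σ ≠ γ 0) :
    ¬ ∃ F : unitInterval → (Fin n → E), Continuous F ∧ F 0 = F 1 ∧
        ∀ t, ∃ τ : Equiv.Perm (Fin n), F t = γ t ∘ τ := by
  rintro ⟨F, hF, hloop, hlist⟩
  obtain ⟨τ, hτ⟩ := exists_perm_forall_eq_comp hγ hinj hF hlist
  refine hne (τ.surjective.injective_comp_right ?_)
  rw [← hσ]
  change γ 1 ∘ τ = γ 0 ∘ τ
  rw [← hτ, ← hτ, hloop]
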